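/- arXiv:2108.13332 — 4 statements merged into one kernel-verified Lean document; each statement's English description precedes it below -/
import Mathlib

section
/- Let x be a sampling distribution on a finite set V of n coded symbols with x(v) ≥ β ≥ 0 for every v ∈ V, let μ be a positive integer, and let Ψ be the (assumed nonempty) family of all stopping sets of size < μ within a larger nonempty family Ψ^∞ of stopping sets (arbitrary nonempty subsets of V). If a light node draws s i.i.d. samples according to x, then every ψ ∈ Ψ^∞ with |ψ| ≥ μ has failure probability at most (1 − βμ)^s, and hence sup_{ψ ∈ Ψ^∞} P_fail(ψ) ≤ max( (max_{ψ∈Ψ} (1 − Σ_{v∈ψ} x(v)))^s , (1 − βμ)^s ). -/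
open Finset

/-- The probability that none of `s` i.i.d. samples, each drawn from the finite set
`V` according to the distribution `x`, lies in the subset `ψ` (the failure
probability for `ψ`). -/
noncomputable def Pfail {V : Type*} [Fintype V] [DecidableEq V]
    (x : V → ℝ) (s : ℕ) (ψ : Finset V) : ℝ :=
  ∑ f ∈ Finset.univ.filter (fun f : Fin s → V => ∀ i, f i ∉ ψ), ∏ i, x (f i)

/-- Independent samples all miss `ψ` with probability the `s`-th power of the mass of `ψᶜ`. -/
theorem Pfail_eq_sum_compl_pow {V : Type*} [Fintype V] [DecidableEq V]
    (x : V → ℝ) (s : ℕ) (ψ : Finset V) : Pfail x s ψ = (∑ v ∈ ψᶜ, x v) ^ s := by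
  have h : Finset.univ.filter (fun f : Fin s → V => ∀ i, f i ∉ ψ) =
      Fintype.piFinset fun _ => ψᶜ := by
    ext f
    simp
  rw [Pfail, h, Finset.sum_prod_piFinset (ψᶜ) (fun _ v => x v)]
  simp

/-- Let `x` be a sampling distribution on `V` with `x v ≥ β ≥ 0` for all `v`, let `μ` be a
positive integer, and let `Ψ` (assumed nonempty) be the family of all stopping sets of
size `< μ` within a larger nonempty family `Ψ∞` of stopping sets (arbitrary nonempty
subsets of `V`).  With `s` i.i.d. samples drawn according to `x`, every `ψ ∈ Ψ∞` with
`|ψ| ≥ μ` has failure probability at most `(1 − βμ)^s`, and hence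
`sup_{ψ ∈ Ψ∞} P_fail(ψ) ≤ max( (max_{ψ∈Ψ} (1 − Σ_{v∈ψ} x v))^s , (1 − βμ)^s )`. -/
theorem stmt3 {V : Type*} [Fintype V] [DecidableEq V] (n s μ : ℕ)
    (hn : Fintype.card V = n) (hμ : 0 < μ)
    (x : V → ℝ) (β : ℝ) (hβ : 0 ≤ β) (hx0 : ∀ v, β ≤ x v) (hx1 : ∑ v, x v = 1)
    (Ψinf : Finset (Finset V)) (hΨinf : Ψinf.Nonempty)
    (hne : ∀ ψ ∈ Ψinf, ψ.Nonempty)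
    (hΨ : (Ψinf.filter fun ψ => ψ.card < μ).Nonempty) :
    (∀ ψ ∈ Ψinf, μ ≤ ψ.card → Pfail x s ψ ≤ (1 - β * μ) ^ s) ∧
    Ψinf.sup' hΨinf (fun ψ => Pfail x s ψ) ≤
      max (((Ψinf.filter fun ψ => ψ.card < μ).sup' hΨ
              (fun ψ => 1 - ∑ v ∈ ψ, x v)) ^ s)
          ((1 - β * μ) ^ s) := by
  have hcompl (ψ : Finset V) : ∑ v ∈ ψᶜ, x v = 1 - ∑ v ∈ ψ, x v := by
    rw [← hx1, ← Finset.sum_add_sum_compl ψ x, add_sub_cancel_left]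
  have hnonneg (ψ : Finset V) : 0 ≤ 1 - ∑ v ∈ ψ, x v := by
    rw [← hcompl]
    exact Finset.sum_nonneg fun v _ => hβ.trans (hx0 v)
  have hPfail (ψ : Finset V) : Pfail x s ψ = (1 - ∑ v ∈ ψ, x v) ^ s := by
    rw [Pfail_eq_sum_compl_pow, hcompl]
  have hlarge : ∀ ψ ∈ Ψinf, μ ≤ ψ.card → Pfail x s ψ ≤ (1 - β * μ) ^ s := by
    intro ψ _ hcard
    have hmass : β * μ ≤ ∑ v ∈ ψ, x v := calc
      β * μ ≤ β * ψ.card := by gcongr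
      _ = ψ.card • β := by rw [nsmul_eq_mul, mul_comm]
      _ ≤ ∑ v ∈ ψ, x v := Finset.card_nsmul_le_sum _ _ _ fun v _ => hx0 v
    rw [hPfail]
    exact pow_le_pow_left₀ (hnonneg ψ) (sub_le_sub_left hmass 1) s
  refine ⟨hlarge, Finset.sup'_le _ _ fun ψ hψ => ?_⟩
  rcases lt_or_ge ψ.card μ with hcard | hcard
  · rw [hPfail]
    exact le_max_of_le_left <| pow_le_pow_left₀ (hnonneg ψ)
      (Finset.le_sup' (fun ψ => 1 - ∑ v ∈ ψ, x v) (Finset.mem_filter.2 ⟨hψ, hcard⟩)) s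
  · exact le_max_of_le_right (hlarge ψ hψ hcard)
end

section
/- Let x be a sampling distribution on a finite set B of base-layer coded symbols, let V_j be a finite set of layer-j coded symbols partitioned into disjoint sets D_j (data symbols) and P_j (parity symbols), and let d : B → D_j and p : B → P_j be the Merkle-proof maps. For v ∈ V_j define x^(j)(v) = Σ_{i : d(i) = v} x(i) + Σ_{i : p(i) = v} x(i). Suppose x^(j)(v) ≥ β ≥ 0 for all v ∈ V_j. Then for every subset ψ ⊆ V_j with |ψ| ≥ μ, the probability that a single base sample drawn according to x satisfies d(i) ∉ ψ and p(i) ∉ ψ is at most 1 − (1/2)·Σ_{v∈ψ} x^(j)(v) ≤ 1 − (1/2)·β·μ, and hence the probability that s i.i.d. base samples all fail to sample ψ is at most (1 − (1/2)·β·μ)^s. -/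
open Finset

/-- The layer-`j` sampling probability induced on a layer-`j` symbol `v` by the
base-layer distribution `x` and the Merkle-proof maps `d` (data) and `p` (parity):
`x^(j)(v) = Σ_{i : d i = v} x i + Σ_{i : p i = v} x i`. -/
noncomputable def layerProb {B Vj : Type*} [Fintype B] [DecidableEq Vj]
    (x : B → ℝ) (d p : B → Vj) (v : Vj) : ℝ :=
  (∑ i ∈ Finset.univ.filter (fun i => d i = v), x i) +
    ∑ i ∈ Finset.univ.filter (fun i => p i = v), x i

/-- The probability that none of `s` i.i.d. base-layer samples drawn according to `x`
samples the layer-`j` subset `ψ` via its Merkle proof (i.e. every sample `i` has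
`d i ∉ ψ` and `p i ∉ ψ`). -/
noncomputable def PfailMerkle {B Vj : Type*} [Fintype B] [DecidableEq B]
    [DecidableEq Vj] (x : B → ℝ) (d p : B → Vj) (s : ℕ) (ψ : Finset Vj) : ℝ :=
  ∑ f ∈ Finset.univ.filter
      (fun f : Fin s → B => ∀ i, d (f i) ∉ ψ ∧ p (f i) ∉ ψ),
    ∏ i, x (f i)

/-- The total layer probability of `ψ` counts each base symbol once for every one of its
two Merkle-proof symbols that lies in `ψ`. -/
theorem sum_layerProb {B Vj : Type*} [Fintype B] [DecidableEq Vj]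
    (x : B → ℝ) (d p : B → Vj) (ψ : Finset Vj) :
    ∑ v ∈ ψ, layerProb x d p v =
      ∑ i, ((if d i ∈ ψ then x i else 0) + if p i ∈ ψ then x i else 0) := by
  simp only [layerProb, Finset.sum_add_distrib, Finset.sum_fiberwise_eq_sum_filter]
  simp only [Finset.sum_filter]

/-- A single sample misses `ψ` with probability at most one minus half the total layer
probability of `ψ`. -/
theorem sum_filter_notMem_le {B Vj : Type*} [Fintype B] [DecidableEq Vj]
    (x : B → ℝ) (hx0 : ∀ i, 0 ≤ x i) (hx1 : ∑ i, x i = 1) (d p : B → Vj)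
    (ψ : Finset Vj) :
    ∑ i ∈ Finset.univ.filter (fun i => d i ∉ ψ ∧ p i ∉ ψ), x i ≤
      1 - (1 / 2) * ∑ v ∈ ψ, layerProb x d p v := by
  rw [sum_layerProb, Finset.mul_sum, le_sub_iff_add_le, Finset.sum_filter,
    ← Finset.sum_add_distrib]
  refine le_of_le_of_eq ?_ hx1
  refine Finset.sum_le_sum fun i _ => ?_
  have := hx0 i
  by_cases h1 : d i ∈ ψ <;> by_cases h2 : p i ∈ ψ <;> simp [h1, h2] <;> linarith

/-- Independence: all `s` samples miss `ψ` with the `s`-th power of the probability that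
one sample does. -/
theorem PfailMerkle_eq_pow {B Vj : Type*} [Fintype B] [DecidableEq B] [DecidableEq Vj]
    (x : B → ℝ) (d p : B → Vj) (s : ℕ) (ψ : Finset Vj) :
    PfailMerkle x d p s ψ =
      (∑ i ∈ Finset.univ.filter (fun i => d i ∉ ψ ∧ p i ∉ ψ), x i) ^ s := by
  rw [PfailMerkle, Finset.sum_pow']
  refine Finset.sum_congr ?_ fun _ _ => rfl
  ext f
  simp

/-- `Vj` is partitioned into disjoint data symbols `Dj` and parity symbols `Pj`, the
Merkle-proof maps satisfy `d i ∈ Dj` and `p i ∈ Pj`, and the induced layer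
probabilities satisfy `x^(j)(v) ≥ β ≥ 0`.  Then for every `ψ ⊆ Vj` with `|ψ| ≥ μ`,
the probability that a single base sample `i` drawn according to `x` satisfies
`d i ∉ ψ` and `p i ∉ ψ` is at most `1 − (1/2)·Σ_{v∈ψ} x^(j)(v) ≤ 1 − (1/2)·β·μ`, and
hence the probability that `s` i.i.d. base samples all fail to sample `ψ` is at most
`(1 − (1/2)·β·μ)^s`. -/
theorem stmt5 {B Vj : Type*} [Fintype B] [DecidableEq B] [Fintype Vj] [DecidableEq Vj]
    (s μ : ℕ)
    (x : B → ℝ) (hx0 : ∀ i, 0 ≤ x i) (hx1 : ∑ i, x i = 1)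
    (Dj Pj : Finset Vj) (hdisj : Disjoint Dj Pj) (hcover : Dj ∪ Pj = Finset.univ)
    (d p : B → Vj) (hd : ∀ i, d i ∈ Dj) (hp : ∀ i, p i ∈ Pj)
    (β : ℝ) (hβ : 0 ≤ β) (hβle : ∀ v : Vj, β ≤ layerProb x d p v) :
    ∀ ψ : Finset Vj, μ ≤ ψ.card →
      (∑ i ∈ Finset.univ.filter (fun i => d i ∉ ψ ∧ p i ∉ ψ), x i ≤
          1 - (1 / 2) * ∑ v ∈ ψ, layerProb x d p v) ∧
      (1 - (1 / 2) * ∑ v ∈ ψ, layerProb x d p v ≤ 1 - (1 / 2) * β * μ) ∧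
      PfailMerkle x d p s ψ ≤ (1 - (1 / 2) * β * μ) ^ s := by
  intro ψ hψ
  have h1 := sum_filter_notMem_le x hx0 hx1 d p ψ
  have h2 : 1 - (1 / 2) * ∑ v ∈ ψ, layerProb x d p v ≤ 1 - (1 / 2) * β * μ := by
    have hcard : (ψ.card : ℝ) * β ≤ ∑ v ∈ ψ, layerProb x d p v := by
      simpa using Finset.card_nsmul_le_sum ψ _ β fun v _ => hβle v
    have hμ : (μ : ℝ) * β ≤ ψ.card * β := by gcongr
    linarith
  refine ⟨h1, h2, ?_⟩
  rw [PfailMerkle_eq_pow]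
  exact pow_le_pow_left₀ (Finset.sum_nonneg fun i _ => hx0 i) (h1.trans h2) s
end

section
/- Let T i.i.d. samples be drawn uniformly at random (with replacement) from a finite set V of n elements, and let k be an integer with 0 < k < n. Then the probability that the number of distinct sampled values is at most k is at most C(n, k) · (k/n)^T ≤ 2^{n·h(k/n) − T·log₂(n/k)}, where h(q) = −q·log₂(q) − (1−q)·log₂(1−q) is the binary entropy function and C(n, k) is the binomial coefficient. -/
open Finset

/-- The binary entropy function `h(q) = −q·log₂ q − (1−q)·log₂(1−q)`. -/
noncomputable def binEnt (q : ℝ) : ℝ :=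
  -q * Real.logb 2 q - (1 - q) * Real.logb 2 (1 - q)

/-- At most `C(|V|, k) · k ^ |ι|` maps from `ι` to `V` have an image with at most `k`
elements. -/
theorem card_filter_card_image_le {ι V : Type*} [Fintype ι] [DecidableEq ι] [Fintype V]
    [DecidableEq V] {k : ℕ} (hk : k ≤ Fintype.card V) :
    #{f : ι → V | #(univ.image f) ≤ k} ≤ (Fintype.card V).choose k * k ^ Fintype.card ι := by
  have hsub : ({f : ι → V | #(univ.image f) ≤ k} : Finset (ι → V)) ⊆
      (powersetCard k univ).biUnion fun s ↦ Fintype.piFinset fun _ : ι ↦ s := by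
    intro f hf
    obtain ⟨s, hfs, -, hs⟩ :=
      exists_subsuperset_card_eq (subset_univ (univ.image f)) (mem_filter.mp hf).2 hk
    refine mem_biUnion.mpr ⟨s, mem_powersetCard.mpr ⟨subset_univ s, hs⟩, ?_⟩
    exact Fintype.mem_piFinset.mpr fun i ↦ hfs (mem_image_of_mem f (mem_univ i))
  calc
    _ ≤ #(powersetCard k (univ : Finset V)) * k ^ Fintype.card ι := by
      refine (card_le_card hsub).trans (card_biUnion_le_card_mul _ _ _ fun s hs ↦ ?_)
      simp [(mem_powersetCard.mp hs).2]
    _ = _ := by rw [card_powersetCard, card_univ]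

/-- A single term of the binomial expansion of `(q + (1 - q)) ^ n` is at most `1`. -/
theorem choose_mul_pow_mul_one_sub_pow_le_one {n k : ℕ} (hkn : k ≤ n) {q : ℝ} (hq0 : 0 ≤ q)
    (hq1 : q ≤ 1) : (n.choose k : ℝ) * (q ^ k * (1 - q) ^ (n - k)) ≤ 1 := by
  have hq : 0 ≤ 1 - q := sub_nonneg.mpr hq1
  calc
    _ = q ^ k * (1 - q) ^ (n - k) * (n.choose k : ℝ) := mul_comm _ _
    _ ≤ ∑ m ∈ range (n + 1), q ^ m * (1 - q) ^ (n - m) * (n.choose m : ℝ) :=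
      single_le_sum (f := fun m ↦ q ^ m * (1 - q) ^ (n - m) * (n.choose m : ℝ))
        (fun m _ ↦ by positivity) (mem_range.mpr (Nat.lt_succ_of_le hkn))
    _ = 1 := by rw [← add_pow]; simp

/-- The closed form of `2 ^ (n · h(k / n))`. -/
theorem two_rpow_mul_binEnt {n k : ℕ} (hk0 : 0 < k) (hkn : k < n) :
    (2 : ℝ) ^ ((n : ℝ) * binEnt ((k : ℝ) / n)) =
      (((k : ℝ) / n) ^ k * (1 - (k : ℝ) / n) ^ (n - k))⁻¹ := by
  have hk : (0 : ℝ) < k := by exact_mod_cast hk0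
  have hn : (0 : ℝ) < n := by exact_mod_cast hk0.trans hkn
  have hq : 0 < (k : ℝ) / n := by positivity
  have hq' : 0 < 1 - (k : ℝ) / n :=
    sub_pos.mpr ((div_lt_one hn).mpr (by exact_mod_cast hkn))
  have hlog : (n : ℝ) * binEnt ((k : ℝ) / n) =
      Real.logb 2 (((k : ℝ) / n) ^ k * (1 - (k : ℝ) / n) ^ (n - k))⁻¹ := by
    rw [Real.logb_inv, Real.logb_mul (by positivity) (by positivity), Real.logb_pow,
      Real.logb_pow, Nat.cast_sub hkn.le, binEnt]
    generalize Real.logb 2 (1 - (k : ℝ) / n) = b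
    generalize Real.logb 2 ((k : ℝ) / n) = a
    field_simp
    ring
  rw [hlog, Real.rpow_logb two_pos (by norm_num) (by positivity)]

/-- The binomial coefficient is bounded by the exponential of the entropy. -/
theorem choose_le_two_rpow_mul_binEnt {n k : ℕ} (hk0 : 0 < k) (hkn : k < n) :
    (n.choose k : ℝ) ≤ (2 : ℝ) ^ ((n : ℝ) * binEnt ((k : ℝ) / n)) := by
  have hk : (0 : ℝ) < k := by exact_mod_cast hk0
  have hn : (0 : ℝ) < n := by exact_mod_cast hk0.trans hkn
  have hq1 : (k : ℝ) / n < 1 := (div_lt_one hn).mpr (by exact_mod_cast hkn)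
  have hq' : 0 < 1 - (k : ℝ) / n := sub_pos.mpr hq1
  rw [two_rpow_mul_binEnt hk0 hkn, ← one_div, le_div_iff₀ (by positivity)]
  exact choose_mul_pow_mul_one_sub_pow_le_one hkn.le (by positivity) hq1.le

/-- Let `T` i.i.d. samples be drawn uniformly at random (with replacement) from a finite
set `V` of `n` elements, and let `0 < k < n`.  Then the probability that the number
of distinct sampled values is at most `k` (each outcome `f : Fin T → V` having
probability `∏ i, 1/n`) is at most `C(n, k) · (k/n)^T`, which in turn is at most
`2^{n·h(k/n) − T·log₂(n/k)}`. -/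
theorem stmt9 {V : Type*} [Fintype V] [DecidableEq V] (n T k : ℕ)
    (hn : Fintype.card V = n) (hk0 : 0 < k) (hkn : k < n) :
    (∑ f ∈ Finset.univ.filter
        (fun f : Fin T → V => (Finset.univ.image f).card ≤ k),
      ∏ _i : Fin T, ((n : ℝ))⁻¹) ≤
        (n.choose k : ℝ) * ((k : ℝ) / (n : ℝ)) ^ T ∧
    (n.choose k : ℝ) * ((k : ℝ) / (n : ℝ)) ^ T ≤
      (2 : ℝ) ^ ((n : ℝ) * binEnt ((k : ℝ) / (n : ℝ)) -
        (T : ℝ) * Real.logb 2 ((n : ℝ) / (k : ℝ))) := by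
  have hk : (0 : ℝ) < k := by exact_mod_cast hk0
  have hn' : (0 : ℝ) < n := by exact_mod_cast hk0.trans hkn
  constructor
  · have hcard := card_filter_card_image_le (ι := Fin T) (hn ▸ hkn.le : k ≤ Fintype.card V)
    rw [hn, Fintype.card_fin] at hcard
    rw [prod_const, sum_const, nsmul_eq_mul, card_univ, Fintype.card_fin, div_pow,
      div_eq_mul_inv, ← inv_pow, ← mul_assoc]
    gcongr
    exact_mod_cast hcard
  · have hT : (2 : ℝ) ^ (-((T : ℝ) * Real.logb 2 ((n : ℝ) / k))) = ((k : ℝ) / n) ^ T := by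
      rw [← mul_neg, ← Real.logb_inv, inv_div, ← Real.logb_pow,
        Real.rpow_logb two_pos (by norm_num) (by positivity)]
    rw [sub_eq_add_neg, Real.rpow_add two_pos, hT]
    gcongr
    exact choose_le_two_rpow_mul_binEnt hk0 hkn
end

section
/- Let x be a sampling distribution on a finite set V of n coded symbols, let T i.i.d. samples be drawn according to x, and let k be an integer with 0 < k < n. Let σ_k denote the sum of the k largest values of x, and assume σ_k > 0. Then the probability that the number of distinct sampled values is at most k is at most 2^{n·h(k/n) − T·log₂(1/σ_k)}, where h(q) = −q·log₂(q) − (1−q)·log₂(1−q) is the binary entropy function. -/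
open Finset

/-- The binomial coefficient is bounded by the exponential of the binary entropy. -/
theorem choose_le_two_rpow_binEnt {n k : ℕ} (hk0 : 0 < k) (hkn : k < n) :
    (n.choose k : ℝ) ≤ (2 : ℝ) ^ ((n : ℝ) * binEnt ((k : ℝ) / (n : ℝ))) := by
  have hn : (0 : ℝ) < n := by exact_mod_cast hk0.trans hkn
  set p : ℝ := k / n with hp
  have hp0 : 0 < p := div_pos (by exact_mod_cast hk0) hn
  have hp1 : 0 < 1 - p := sub_pos.mpr ((div_lt_one hn).mpr (by exact_mod_cast hkn))
  have hterm : p ^ k * (1 - p) ^ (n - k) * (n.choose k : ℝ) ≤ 1 := by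
    have h := add_pow p (1 - p) n
    rw [add_sub_cancel, one_pow] at h
    refine le_of_le_of_eq ?_ h.symm
    exact single_le_sum (f := fun m => p ^ m * (1 - p) ^ (n - m) * (n.choose m : ℝ))
      (fun m _ => by positivity) (mem_range.mpr (Nat.lt_succ_of_lt hkn))
  have hpow : (2 : ℝ) ^ ((n : ℝ) * binEnt p) = (p ^ k * (1 - p) ^ (n - k))⁻¹ := by
    have hexp : (n : ℝ) * binEnt p =
        -(Real.logb 2 p * k + Real.logb 2 (1 - p) * ((n - k : ℕ) : ℝ)) := by
      have hnp : (k : ℝ) = n * p := by rw [hp]; field_simp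
      rw [Nat.cast_sub hkn.le, hnp, binEnt]
      ring
    rw [hexp, Real.rpow_neg two_pos.le, Real.rpow_add two_pos, Real.rpow_mul two_pos.le,
      Real.rpow_mul two_pos.le, Real.rpow_logb two_pos (by norm_num) hp0,
      Real.rpow_logb two_pos (by norm_num) hp1, Real.rpow_natCast, Real.rpow_natCast]
  rw [hpow, ← one_div, le_div_iff₀ (by positivity), mul_comm]
  exact hterm

/-- Union bound: the weight of the words with at most `k` distinct letters is at most the
total weight, over all `k`-element alphabets, of the words over that alphabet. -/
theorem sum_prod_filter_card_image_le {V : Type*} [Fintype V] [DecidableEq V] {T k : ℕ}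
    (hk : k ≤ Fintype.card V) {x : V → ℝ} (hx : ∀ v, 0 ≤ x v) :
    (∑ f ∈ univ.filter (fun f : Fin T → V => (univ.image f).card ≤ k), ∏ i, x (f i)) ≤
      ∑ S ∈ (univ : Finset V).powersetCard k, (∑ v ∈ S, x v) ^ T := by
  have hpow (S : Finset V) :
      (∑ v ∈ S, x v) ^ T = ∑ f ∈ Fintype.piFinset (fun _ : Fin T => S), ∏ i, x (f i) := by
    simpa using prod_univ_sum (fun _ : Fin T => S) (fun _ v => x v)
  simp_rw [hpow]
  calc
    _ ≤ ∑ f : Fin T → V, ∑ S ∈ (univ : Finset V).powersetCard k,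
          if f ∈ Fintype.piFinset (fun _ : Fin T => S) then ∏ i, x (f i) else 0 := by
      have hnonneg (f : Fin T → V) : 0 ≤ ∏ i, x (f i) := prod_nonneg fun i _ => hx _
      have hite (f : Fin T → V) (S : Finset V) :
          0 ≤ if f ∈ Fintype.piFinset (fun _ : Fin T => S) then ∏ i, x (f i) else 0 := by
        split_ifs
        exacts [hnonneg f, le_rfl]
      rw [sum_filter]
      refine sum_le_sum fun f _ => ?_
      split_ifs with hf
      · obtain ⟨S, hfS, -, hS⟩ := exists_subsuperset_card_eq (subset_univ (univ.image f)) hf hk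
        have hmem : f ∈ Fintype.piFinset (fun _ : Fin T => S) :=
          Fintype.mem_piFinset.mpr fun i => hfS (mem_image_of_mem f (mem_univ i))
        have hle := single_le_sum (fun S _ => hite f S)
          (mem_powersetCard.mpr ⟨subset_univ S, hS⟩)
        rwa [if_pos hmem] at hle
      · exact sum_nonneg fun S _ => hite f S
    _ = _ := by
      rw [sum_comm]
      exact sum_congr rfl fun S _ => by rw [← sum_filter, filter_mem_eq_inter, univ_inter]

/-- Let `x` be a sampling distribution on a finite set `V` of `n` coded symbols, let `T`
i.i.d. samples be drawn according to `x`, and let `0 < k < n`.  Let `σ_k` be the sum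
of the `k` largest values of `x` (equivalently, the maximum over `k`-element subsets
`S ⊆ V` of `Σ_{v∈S} x v`), and assume `σ_k > 0`.  Then the probability that the
number of distinct sampled values is at most `k` (summing the outcome probabilities
`∏ i, x (f i)` over outcomes `f : Fin T → V` taking at most `k` distinct values) is
at most `2^{n·h(k/n) − T·log₂(1/σ_k)}`. -/
theorem stmt10 {V : Type*} [Fintype V] [DecidableEq V] (n T k : ℕ)
    (hn : Fintype.card V = n) (hk0 : 0 < k) (hkn : k < n)
    (x : V → ℝ) (hx0 : ∀ v, 0 ≤ x v) (hx1 : ∑ v, x v = 1)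
    (hσpos : 0 < (Finset.univ.powersetCard k).sup'
        (Finset.powersetCard_nonempty.mpr (by simpa [hn] using hkn.le))
        (fun S => ∑ v ∈ S, x v)) :
    (∑ f ∈ Finset.univ.filter
        (fun f : Fin T → V => (Finset.univ.image f).card ≤ k),
      ∏ i, x (f i)) ≤
      (2 : ℝ) ^ ((n : ℝ) * binEnt ((k : ℝ) / (n : ℝ)) -
        (T : ℝ) * Real.logb 2
          (1 / (Finset.univ.powersetCard k).sup'
              (Finset.powersetCard_nonempty.mpr (by simpa [hn] using hkn.le))
              (fun S => ∑ v ∈ S, x v))) := by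
  set σ := (Finset.univ.powersetCard k).sup'
    (Finset.powersetCard_nonempty.mpr (by simpa [hn] using hkn.le))
    (fun S => ∑ v ∈ S, x v) with hσ
  have hpow : (2 : ℝ) ^ ((n : ℝ) * binEnt ((k : ℝ) / (n : ℝ)) - T * Real.logb 2 (1 / σ)) =
      2 ^ ((n : ℝ) * binEnt ((k : ℝ) / (n : ℝ))) * σ ^ T := by
    rw [one_div, Real.logb_inv, mul_neg, sub_neg_eq_add, Real.rpow_add two_pos,
      mul_comm (T : ℝ), Real.rpow_mul two_pos.le (Real.logb 2 σ), Real.rpow_logb two_pos (by norm_num) hσpos,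
      Real.rpow_natCast]
  calc
    _ ≤ ∑ S ∈ (univ : Finset V).powersetCard k, (∑ v ∈ S, x v) ^ T :=
      sum_prod_filter_card_image_le (by omega) hx0
    _ ≤ ∑ S ∈ (univ : Finset V).powersetCard k, σ ^ T :=
      sum_le_sum fun S hS => pow_le_pow_left₀ (sum_nonneg fun v _ => hx0 v)
        (le_sup' (fun S => ∑ v ∈ S, x v) hS) T
    _ = n.choose k * σ ^ T := by
      rw [sum_const, card_powersetCard, card_univ, hn, nsmul_eq_mul]
    _ ≤ 2 ^ ((n : ℝ) * binEnt ((k : ℝ) / (n : ℝ))) * σ ^ T := by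
      gcongr
      exact choose_le_two_rpow_binEnt hk0 hkn
    _ = _ := hpow.symm
end
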